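/- Let R be a Dedekind domain and Λ a finite R-algebra (finitely generated as an R-module). Then there exist orthogonal idempotents e₀ and e₁ = 1 − e₀ in Λ such that, writing Λ_{ij} = e_i Λ e_j: (1) Λ_{ij} is an R-torsion module (hence of finite length) whenever (i,j) ≠ (1,1); (2) Λ_{01}, Λ_{10} and the R-torsion submodule of Λ_{11} are all contained in nil Λ; (3) the quotient Λ_{11}/nil(Λ_{11}) is semiprime and torsion-free as an R-module. -/

import Mathlib

noncomputable section

/-- A subset of a ring is nilpotent (as an ideal-like set) if all sufficiently
long products of its elements vanish. -/
def IsNilpotentSet {Λ : Type} [Ring Λ] (I : Set Λ) : Prop :=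
  ∃ n : ℕ, ∀ f : Fin (n + 1) → Λ, (∀ k, f k ∈ I) → (List.ofFn f).prod = 0

/-- A two-sided ideal is nilpotent if all sufficiently long products of its
elements vanish. -/
def IsNilpotentTwoSidedIdeal {Λ : Type} [Ring Λ] (I : TwoSidedIdeal Λ) : Prop :=
  IsNilpotentSet (I : Set Λ)

/-- The nilradical (prime radical; the largest nilpotent two-sided ideal of a
noetherian ring) of a ring. -/
def nilRad (Λ : Type) [Ring Λ] : TwoSidedIdeal Λ :=
  sSup {I | IsNilpotentTwoSidedIdeal I}

/-- A subset `I` of the Peirce corner `eΛe` is a two-sided ideal of the corner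
ring `eΛe`. -/
def IsCornerIdeal {Λ : Type} [Ring Λ] (e : Λ) (I : Set Λ) : Prop :=
  (∀ x ∈ I, x = e * x * e) ∧ (0 ∈ I) ∧
  (∀ x ∈ I, ∀ y ∈ I, x + y ∈ I) ∧ (∀ x ∈ I, -x ∈ I) ∧
  (∀ x ∈ I, ∀ a : Λ, (e * a * e) * x ∈ I ∧ x * (e * a * e) ∈ I)

/-- The nilradical of the corner ring `eΛe`: the union of all nilpotent
two-sided ideals of `eΛe`. -/
def cornerNil {Λ : Type} [Ring Λ] (e : Λ) : Set Λ :=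
  ⋃₀ {I | IsCornerIdeal e I ∧ IsNilpotentSet I}


open scoped nonZeroDivisors in
lemma aux_uniform_torsion (R : Type) [CommRing R] [IsDedekindDomain R]
    (Λ : Type) [Ring Λ] [Algebra R Λ] [Module.Finite R Λ] :
    ∃ r : R, r ≠ 0 ∧ ∀ x : Λ, (∃ s : R, s ≠ 0 ∧ s • x = 0) → r • x = 0 := by
  have hT : Module.IsTorsion R (Submodule.torsion R Λ) := Submodule.torsion_isTorsion
  obtain ⟨r, hr, hr0⟩ := Submodule.annihilator_top_inter_nonZeroDivisors hT
  refine ⟨r, nonZeroDivisors.ne_zero hr0, ?_⟩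
  rintro x ⟨s, hs, hsx⟩
  have hx : x ∈ Submodule.torsion R Λ :=
    ⟨⟨s, mem_nonZeroDivisors_of_ne_zero hs⟩, hsx⟩
  have := Submodule.mem_annihilator.mp hr ⟨x, hx⟩ trivial
  exact congrArg Subtype.val this

lemma aux_artinian (R : Type) [CommRing R] [IsDedekindDomain R] (r : R)
    (hr : r ≠ 0) : IsArtinianRing (R ⧸ Ideal.span {r}) := by
  rw [isArtinianRing_iff_krullDimLE_zero]
  refine Ring.KrullDimLE.mk₀ fun I hI => ?_
  have h1 : (I.comap (Ideal.Quotient.mk (Ideal.span {r}))).IsMaximal := by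
    refine Ideal.IsPrime.isMaximal (Ideal.comap_isPrime _ _) ?_
    intro hbot
    have : r ∈ I.comap (Ideal.Quotient.mk (Ideal.span {r})) := by
      rw [Ideal.mem_comap, Ideal.Quotient.eq_zero_iff_mem.mpr (Ideal.mem_span_singleton_self r)]
      exact I.zero_mem
    rw [hbot] at this
    exact hr this
  rw [← Ideal.map_comap_of_surjective _ Ideal.Quotient.mk_surjective I]
  refine (Ideal.map_eq_top_or_isMaximal_of_surjective _ Ideal.Quotient.mk_surjective h1).resolve_left ?_
  rw [Ideal.map_comap_of_surjective _ Ideal.Quotient.mk_surjective I]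
  exact hI.ne_top

lemma aux_list_prod {B : Type} [Ring B] (J : Ideal B) [J.IsTwoSided] (l : List B)
    (h : ∀ x ∈ l, x ∈ J) : l.prod ∈ J ^ l.length := by
  induction l with
  | nil => rw [List.prod_nil, List.length_nil, Submodule.pow_zero, Ideal.one_eq_top]; trivial
  | cons a l ih =>
    rw [List.prod_cons, List.length_cons, Ideal.IsTwoSided.pow_succ]
    exact Ideal.mul_mem_mul (h a (by simp)) (ih fun x hx => h x (by simp [hx]))

lemma aux_quotient (R : Type) [CommRing R] [IsDedekindDomain R]
    (Λ : Type) [Ring Λ] [Algebra R Λ] [Module.Finite R Λ] (r : R) (hr : r ≠ 0) :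
    ∃ (C : Type) (_ : Ring C) (_ : IsSemisimpleRing C) (p : Λ →+* C),
      Function.Surjective p ∧ ∃ n : ℕ, ∀ f : Fin (n + 1) → Λ, (∀ k, p (f k) = 0) →
        ∃ y : Λ, (List.ofFn f).prod = r • y := by
  let I : Ideal Λ := Ideal.span {algebraMap R Λ r}
  have hI : ∀ x, x ∈ I ↔ ∃ y, x = r • y := by
    intro x
    rw [Ideal.mem_span_singleton']
    constructor
    · rintro ⟨a, rfl⟩
      exact ⟨a, by rw [Algebra.smul_def, Algebra.commutes]⟩
    · rintro ⟨a, rfl⟩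
      exact ⟨a, by rw [Algebra.smul_def, Algebra.commutes]⟩
  have : I.IsTwoSided := ⟨by
    intro a b ha
    obtain ⟨y, rfl⟩ := (hI a).1 ha
    exact (hI _).2 ⟨y * b, by rw [smul_mul_assoc]⟩⟩
  have hart : IsArtinianRing (R ⧸ Ideal.span {r}) := aux_artinian R r hr
  have htors : Module.IsTorsionBy R (Λ ⧸ I) r := by
    intro x
    obtain ⟨x, rfl⟩ := Ideal.Quotient.mk_surjective x
    have : r • (Ideal.Quotient.mk I x) = Ideal.Quotient.mk I (r • x) := rfl
    rw [this, Ideal.Quotient.eq_zero_iff_mem]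
    exact (hI _).2 ⟨x, rfl⟩
  have htors' : Module.IsTorsionBySet R (Λ ⧸ I) (Ideal.span {r} : Ideal R) := by
    rwa [← Module.isTorsionBySet_span_singleton_iff] at htors
  let : Module (R ⧸ Ideal.span {r}) (Λ ⧸ I) := htors'.module
  have : IsScalarTower R (R ⧸ Ideal.span {r}) (Λ ⧸ I) := htors'.isScalarTower
  have : Module.Finite R (Λ ⧸ I) :=
    Module.Finite.of_surjective (Ideal.Quotient.mkₐ R I).toLinearMap Ideal.Quotient.mk_surjective
  have : Module.Finite (R ⧸ Ideal.span {r}) (Λ ⧸ I) :=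
    Module.Finite.of_restrictScalars_finite R _ _
  have : IsScalarTower (R ⧸ Ideal.span {r}) (Λ ⧸ I) (Λ ⧸ I) := ⟨by
    intro a x y
    obtain ⟨a, rfl⟩ := Ideal.Quotient.mk_surjective a
    exact smul_assoc a x y⟩
  have : IsArtinianRing (Λ ⧸ I) := IsArtinianRing.of_finite (R ⧸ Ideal.span {r}) _
  obtain ⟨n, hn⟩ := IsSemiprimaryRing.isNilpotent (R := Λ ⧸ I)
  refine ⟨(Λ ⧸ I) ⧸ Ring.jacobson (Λ ⧸ I), inferInstance, inferInstance,
    (Ideal.Quotient.mk _).comp (Ideal.Quotient.mk I),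
    Ideal.Quotient.mk_surjective.comp Ideal.Quotient.mk_surjective, n, fun f hf => ?_⟩
  rw [← hI, ← Ideal.Quotient.eq_zero_iff_mem, map_list_prod]
  have := aux_list_prod (Ring.jacobson (Λ ⧸ I)) ((List.ofFn f).map (Ideal.Quotient.mk I)) (by
    intro x hx
    simp only [List.mem_map, List.mem_ofFn] at hx
    obtain ⟨_, ⟨k, rfl⟩, rfl⟩ := hx
    exact Ideal.Quotient.eq_zero_iff_mem.mp (hf k))
  rw [List.length_map, List.length_ofFn, Ideal.IsTwoSided.pow_succ, hn] at this
  simpa using this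

lemma aux_central {C : Type} [Ring C] [IsSemisimpleRing C] (I : TwoSidedIdeal C) :
    ∃ f ∈ I, ∀ x ∈ I, f * x = x ∧ x * f = x := by
  have key : ∀ {D : Type} [Ring D] [IsSemisimpleRing D] (I : TwoSidedIdeal D),
      ∃ f ∈ I, ∀ x ∈ I, x * f = x := by
    intro D _ _ I
    obtain ⟨f, hf, h⟩ := IsSemisimpleRing.ideal_eq_span_idempotent (TwoSidedIdeal.asIdeal I)
    have hm : ∀ x, x ∈ I ↔ ∃ a, a * f = x := by
      intro x
      rw [← TwoSidedIdeal.mem_asIdeal, h]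
      exact Ideal.mem_span_singleton'
    refine ⟨f, (hm f).2 ⟨1, one_mul f⟩, fun x hx => ?_⟩
    obtain ⟨a, rfl⟩ := (hm x).1 hx
    rw [mul_assoc, hf.eq]
  obtain ⟨f, hf, h⟩ := key I
  obtain ⟨g, hg, h'⟩ := key I.op
  have h2 : ∀ x ∈ I, g.unop * x = x := fun x hx => by
    have := h' (MulOpposite.op x) (TwoSidedIdeal.mem_op_iff.2 hx)
    exact congrArg MulOpposite.unop this
  have hfg : f = g.unop := by rw [← h2 f hf]; exact h _ (TwoSidedIdeal.mem_op_iff.1 hg)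
  exact ⟨f, hf, fun x hx => ⟨by rw [hfg]; exact h2 x hx, h x hx⟩⟩

lemma aux_idem (R : Type) [CommRing R] [IsDedekindDomain R]
    (Λ : Type) [Ring Λ] [Algebra R Λ] [Module.Finite R Λ] :
    ∃ (N : TwoSidedIdeal Λ) (e : Λ), IsNilpotentTwoSidedIdeal N ∧ IsIdempotentElem e ∧
      (∃ s : R, s ≠ 0 ∧ s • e = 0) ∧
      ∀ x : Λ, (∃ s : R, s ≠ 0 ∧ s • x = 0) → e * x - x ∈ N ∧ x * e - x ∈ N := by
  obtain ⟨r, hr, hrT⟩ := aux_uniform_torsion R Λ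
  obtain ⟨C, _, _, p, hp, n, hn⟩ := aux_quotient R Λ r hr
  let I : TwoSidedIdeal C := TwoSidedIdeal.mk' {y | ∃ x : Λ, r • x = 0 ∧ p x = y}
    ⟨0, by simp, by simp⟩
    (by rintro _ _ ⟨x, hx, rfl⟩ ⟨y, hy, rfl⟩
        exact ⟨x + y, by rw [smul_add, hx, hy, add_zero], map_add _ _ _⟩)
    (by rintro _ ⟨x, hx, rfl⟩
        exact ⟨-x, by rw [smul_neg, hx, neg_zero], map_neg _ _⟩)
    (by rintro a _ ⟨x, hx, rfl⟩
        obtain ⟨a, rfl⟩ := hp a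
        exact ⟨a * x, by rw [← mul_smul_comm, hx, mul_zero], map_mul _ _ _⟩)
    (by rintro _ a ⟨x, hx, rfl⟩
        obtain ⟨a, rfl⟩ := hp a
        exact ⟨x * a, by rw [← smul_mul_assoc, hx, zero_mul], map_mul _ _ _⟩)
  have hI : ∀ y, y ∈ I ↔ ∃ x : Λ, r • x = 0 ∧ p x = y := fun y => by
    simp only [I, TwoSidedIdeal.mem_mk', Set.mem_ofPred_eq]
  let N : TwoSidedIdeal Λ := TwoSidedIdeal.mk' {x | r • x = 0 ∧ p x = 0}
    ⟨by simp, by simp⟩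
    (by rintro x y ⟨hx, hx'⟩ ⟨hy, hy'⟩
        exact ⟨by rw [smul_add, hx, hy, add_zero], by rw [map_add, hx', hy', add_zero]⟩)
    (by rintro x ⟨hx, hx'⟩
        exact ⟨by rw [smul_neg, hx, neg_zero], by rw [map_neg, hx', neg_zero]⟩)
    (by rintro a x ⟨hx, hx'⟩
        exact ⟨by rw [← mul_smul_comm, hx, mul_zero], by rw [map_mul, hx', mul_zero]⟩)
    (by rintro x a ⟨hx, hx'⟩
        exact ⟨by rw [← smul_mul_assoc, hx, zero_mul], by rw [map_mul, hx', zero_mul]⟩)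
  have hN : ∀ x, x ∈ N ↔ r • x = 0 ∧ p x = 0 := fun y => by
    simp only [N, TwoSidedIdeal.mem_mk', Set.mem_ofPred_eq]
  have hnil : IsNilpotentTwoSidedIdeal N := by
    refine ⟨n + 1, fun f hf => ?_⟩
    rw [List.ofFn_succ, List.prod_cons]
    obtain ⟨y, hy⟩ := hn (fun k => f k.succ) (fun k => ((hN _).1 (hf _)).2)
    rw [hy, mul_smul_comm, ← smul_mul_assoc, ((hN _).1 (hf 0)).1, zero_mul]
  obtain ⟨f, hf, hfI⟩ := aux_central I
  obtain ⟨t, ht, rfl⟩ := (hI f).1 hf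
  have hq : ∀ x y : Λ, N.ringCon.mk' x = N.ringCon.mk' y ↔ x - y ∈ N := fun x y => by
    rw [← TwoSidedIdeal.rel_iff]; exact RingCon.eq _
  obtain ⟨e, he, het⟩ := exists_isIdempotentElem_eq_of_ker_isNilpotent N.ringCon.mk' (by
      intro x hx
      rw [RingHom.mem_ker, ← map_zero N.ringCon.mk', hq, sub_zero] at hx
      obtain ⟨m, hm⟩ := hnil
      refine ⟨m + 1, ?_⟩
      have := hm (fun _ => x) (fun _ => hx)
      rwa [List.ofFn_const, List.prod_replicate] at this) (N.ringCon.mk' t) ⟨t, rfl⟩ (by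
      rw [IsIdempotentElem, ← map_mul, hq, hN]
      refine ⟨?_, ?_⟩
      · rw [smul_sub, ← smul_mul_assoc, ht, zero_mul, sub_zero]
      · rw [map_sub, map_mul, (hfI _ hf).1, sub_self])
  rw [hq, hN] at het
  have hre : r • e = 0 := by
    have := het.1
    rwa [smul_sub, ht, sub_zero] at this
  have hpe : p e = p t := by
    have := het.2
    rwa [map_sub, sub_eq_zero] at this
  refine ⟨N, e, hnil, he, ⟨r, hr, hre⟩, fun x hx => ?_⟩
  have hx := hrT x hx
  have hpx := hfI (p x) ((hI _).2 ⟨x, hx, rfl⟩)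
  constructor
  · rw [hN, smul_sub, hx, ← smul_mul_assoc, hre, zero_mul, sub_zero, map_sub, map_mul, hpe,
      hpx.1, sub_self]
    exact ⟨rfl, rfl⟩
  · rw [hN, smul_sub, hx, ← mul_smul_comm, hre, mul_zero, sub_zero, map_sub, map_mul, hpe,
      hpx.2, sub_self]
    exact ⟨rfl, rfl⟩

/-- The corner `eΛe` as an `R`-submodule. -/
def auxE (R : Type) [CommRing R] {Λ : Type} [Ring Λ] [Algebra R Λ] (e : Λ) : Submodule R Λ where
  carrier := {x | ∃ a, x = e * a * e}
  add_mem' := by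
    rintro _ _ ⟨a, rfl⟩ ⟨b, rfl⟩
    exact ⟨a + b, by rw [mul_add, add_mul]⟩
  zero_mem' := ⟨0, by simp⟩
  smul_mem' := by
    rintro c _ ⟨a, rfl⟩
    exact ⟨c • a, by rw [mul_smul_comm, smul_mul_assoc]⟩

section
variable {R : Type} [CommRing R] {Λ : Type} [Ring Λ] [Algebra R Λ]

lemma mem_auxE {e x : Λ} : x ∈ auxE R e ↔ ∃ a, x = e * a * e := Iff.rfl

lemma mem_auxE' {e x : Λ} (he : IsIdempotentElem e) : x ∈ auxE R e ↔ x = e * x * e := by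
  rw [mem_auxE]
  constructor
  · rintro ⟨a, rfl⟩
    have : e * (e * a * e) * e = (e * e) * a * (e * e) := by noncomm_ring
    rw [this, he.eq]
  · intro h
    exact ⟨x, h⟩

lemma auxE_mul (e : Λ) : auxE R e * auxE R e ≤ auxE R e := by
  rw [Submodule.mul_le]
  rintro _ ⟨a, rfl⟩ _ ⟨b, rfl⟩
  exact ⟨a * e * e * b, by noncomm_ring⟩

/-- Corner ideal, for submodules. -/
def auxCI (e : Λ) (M : Submodule R Λ) : Prop :=
  M ≤ auxE R e ∧ auxE R e * M ≤ M ∧ M * auxE R e ≤ M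

lemma auxCI_iff {e : Λ} (he : IsIdempotentElem e) (M : Submodule R Λ) :
    auxCI e M ↔ IsCornerIdeal e (M : Set Λ) := by
  constructor
  · rintro ⟨h1, h2, h3⟩
    exact ⟨fun x hx => (mem_auxE' he).1 (h1 hx), M.zero_mem, fun x hx y hy => M.add_mem hx hy,
      fun x hx => M.neg_mem hx, fun x hx a =>
      ⟨h2 (Submodule.mul_mem_mul ⟨a, rfl⟩ hx), h3 (Submodule.mul_mem_mul hx ⟨a, rfl⟩)⟩⟩
  · rintro ⟨h1, -, -, -, h5⟩
    refine ⟨fun x hx => (mem_auxE' he).2 (h1 x hx), ?_, ?_⟩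
    · rw [Submodule.mul_le]
      rintro _ ⟨a, rfl⟩ x hx
      exact (h5 x hx a).1
    · rw [Submodule.mul_le]
      rintro x hx _ ⟨a, rfl⟩
      exact (h5 x hx a).2

lemma aux_toSubmodule {e : Λ} (he : IsIdempotentElem e) {I : Set Λ} (h : IsCornerIdeal e I) :
    ∃ M : Submodule R Λ, (M : Set Λ) = I := by
  obtain ⟨h1, h2, h3, h4, h5⟩ := h
  refine ⟨{ carrier := I, add_mem' := fun {a b} ha hb => h3 a ha b hb, zero_mem' := h2,
            smul_mem' := ?_ }, rfl⟩
  intro c x hx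
  have h6 := (h5 x hx (c • 1)).1
  have hx' : e * x = x := by
    rw [h1 x hx, ← mul_assoc, ← mul_assoc, he.eq]
  rw [mul_smul_comm, mul_one, smul_mul_assoc, smul_mul_assoc, he.eq, hx'] at h6
  exact h6

lemma aux_nil_iff (M : Submodule R Λ) :
    IsNilpotentSet (M : Set Λ) ↔ ∃ n : ℕ, M ^ (n + 1) = ⊥ := by
  refine exists_congr fun n => ?_
  rw [Submodule.pow_eq_span_pow_set, Submodule.span_eq_bot]
  constructor
  · intro h x hx
    obtain ⟨f, rfl⟩ := Set.mem_pow.1 hx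
    exact h _ fun k => (f k).2
  · intro h f hf
    exact h _ (Set.mem_pow.2 ⟨fun k => ⟨f k, hf k⟩, rfl⟩)

lemma aux_pow_le {e : Λ} {M : Submodule R Λ} (h : auxCI e M) (n : ℕ) :
    M ^ (n + 1) ≤ M := by
  induction n with
  | zero => rw [zero_add, pow_one]
  | succ n ih =>
    rw [pow_succ]
    exact (mul_le_mul' ih h.1).trans h.2.2

lemma aux_sup {e : Λ} {M M' : Submodule R Λ} (h : auxCI e M) (h' : auxCI e M')
    (hM : ∃ n : ℕ, M ^ (n + 1) = ⊥) (hM' : ∃ n : ℕ, M' ^ (n + 1) = ⊥) :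
    auxCI e (M ⊔ M') ∧ ∃ n : ℕ, (M ⊔ M') ^ (n + 1) = ⊥ := by
  obtain ⟨m, hm⟩ := hM
  obtain ⟨n, hn⟩ := hM'
  refine ⟨⟨sup_le h.1 h'.1, ?_, ?_⟩, ?_⟩
  · rw [Submodule.mul_sup]
    exact sup_le_sup h.2.1 h'.2.1
  · rw [Submodule.sup_mul]
    exact sup_le_sup h.2.2 h'.2.2
  · have key : ∀ k : ℕ, (M ⊔ M') ^ (k + 1) ≤ M ^ (k + 1) ⊔ M' := by
      intro k
      induction k with
      | zero => simp only [zero_add, pow_one, le_refl]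
      | succ k ih =>
        rw [pow_succ, pow_succ M (k + 1)]
        refine (mul_le_mul' ih le_rfl).trans ?_
        rw [Submodule.sup_mul, Submodule.mul_sup]
        refine sup_le (sup_le le_sup_left ?_) ?_
        · exact le_sup_of_le_right
            ((mul_le_mul' ((aux_pow_le h k).trans h.1) le_rfl).trans h'.2.1)
        · exact le_sup_of_le_right
            ((mul_le_mul' le_rfl (sup_le h.1 h'.1)).trans h'.2.2)
    have h1 : (M ⊔ M') ^ (m + 1) ≤ M' := by
      have := key m
      rwa [hm, bot_sup_eq] at this
    refine ⟨m * n + m + n, ?_⟩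
    have h2 : ((M ⊔ M') ^ (m + 1)) ^ (n + 1) ≤ M' ^ (n + 1) := pow_le_pow_left' h1 _
    rw [hn, ← pow_mul, le_bot_iff] at h2
    rw [← h2]
    congr 1
    ring

lemma aux_max [IsNoetherian R Λ] {e : Λ} (he : IsIdempotentElem e) :
    ∃ M : Submodule R Λ, auxCI e M ∧ (∃ n : ℕ, M ^ (n + 1) = ⊥) ∧
      cornerNil e = (M : Set Λ) := by
  obtain ⟨M, ⟨hM1, hM2⟩, hmax⟩ := set_has_maximal_iff_noetherian.2 (inferInstance : IsNoetherian R Λ)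
    {M : Submodule R Λ | auxCI e M ∧ ∃ n : ℕ, M ^ (n + 1) = ⊥}
    ⟨⊥, ⟨bot_le, by simp, by simp⟩, 0, by simp⟩
  refine ⟨M, hM1, hM2, Set.Subset.antisymm ?_ ?_⟩
  · rintro x ⟨I, ⟨hI1, hI2⟩, hx⟩
    obtain ⟨M', rfl⟩ := aux_toSubmodule (R := R) he hI1
    have := aux_sup hM1 ((auxCI_iff he M').2 hI1) hM2 ((aux_nil_iff M').1 hI2)
    have h2 : M = M ⊔ M' := eq_of_le_of_not_lt le_sup_left (hmax _ this)
    rw [h2]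
    exact (le_sup_right : M' ≤ M ⊔ M') hx
  · intro x hx
    exact ⟨M, ⟨(auxCI_iff he M).1 hM1, (aux_nil_iff M).2 hM2⟩, hx⟩

lemma aux_semiprime [IsNoetherian R Λ] {e : Λ} (he : IsIdempotentElem e) (x : Λ)
    (hx : x = e * x * e) (h : ∀ a : Λ, x * (e * a * e) * x ∈ cornerNil e) :
    x ∈ cornerNil e := by
  obtain ⟨M, hM1, ⟨n, hn⟩, hM⟩ := aux_max (R := R) he
  simp only [hM, SetLike.mem_coe] at h
  set E : Submodule R Λ := auxE R e with hE
  have hEE : E * E ≤ E := auxE_mul e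
  let X : Submodule R Λ := Submodule.span R {x}
  have hxX : x ∈ X := Submodule.mem_span_singleton_self x
  have hXE : X ≤ E := by
    rw [Submodule.span_singleton_le_iff_mem]; exact ⟨x, hx⟩
  have hXX : X * E * X ≤ M := by
    rw [Submodule.mul_le]
    intro y hy z hz
    obtain ⟨c, rfl⟩ := Submodule.mem_span_singleton.1 hz
    rw [mul_smul_comm]
    refine M.smul_mem _ ?_
    refine Submodule.mul_induction_on (C := fun y => y * x ∈ M) hy ?_ ?_
    · rintro u hu _ ⟨a, rfl⟩
      obtain ⟨d, rfl⟩ := Submodule.mem_span_singleton.1 hu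
      rw [smul_mul_assoc, smul_mul_assoc]
      exact M.smul_mem _ (h a)
    · intro u v hu hv
      rw [add_mul]
      exact M.add_mem hu hv
  have heE : e ∈ E := ⟨1, by rw [mul_one, he.eq]⟩
  let J : Submodule R Λ := E * X * E
  have hJ : auxCI e J := by
    refine ⟨?_, ?_, ?_⟩
    · exact (mul_le_mul' ((mul_le_mul' le_rfl hXE).trans hEE) le_rfl).trans hEE
    · change E * (E * X * E) ≤ E * X * E
      rw [← mul_assoc, ← mul_assoc]
      exact mul_le_mul' (mul_le_mul' hEE le_rfl) le_rfl
    · change E * X * E * E ≤ E * X * E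
      rw [mul_assoc (E * X)]
      exact mul_le_mul' le_rfl hEE
  have hJJ : J ^ 2 ≤ M := by
    have h1 : J ^ 2 = E * (X * (E * E) * X) * E := by
      simp only [J, pow_two, mul_assoc]
    rw [h1]
    have h2 : X * (E * E) * X ≤ M :=
      (mul_le_mul' (mul_le_mul' le_rfl hEE) le_rfl).trans hXX
    exact (mul_le_mul' ((mul_le_mul' le_rfl h2).trans hM1.2.1) le_rfl).trans hM1.2.2
  have hJn : IsNilpotentSet (J : Set Λ) := by
    rw [aux_nil_iff]
    refine ⟨2 * n + 1, ?_⟩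
    have h2 : (J ^ 2) ^ (n + 1) ≤ M ^ (n + 1) := pow_le_pow_left' hJJ _
    rw [hn, ← pow_mul, le_bot_iff] at h2
    exact h2
  refine ⟨J, ⟨(auxCI_iff he J).1 hJ, hJn⟩, ?_⟩
  rw [hx]
  exact Submodule.mul_mem_mul (Submodule.mul_mem_mul heE hxX) heE

lemma aux_torsfree [IsDomain R] [IsNoetherian R Λ] {e : Λ} (he : IsIdempotentElem e)
    (N : TwoSidedIdeal Λ)
    (hN : IsNilpotentTwoSidedIdeal N)
    (ht : ∀ x : Λ, (∃ s : R, s ≠ 0 ∧ s • (e * x * e) = 0) → e * x * e ∈ N)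
    (x : Λ) (hx : x = e * x * e) (r : R) (hr : r ≠ 0) (h : r • x ∈ cornerNil e) :
    x ∈ cornerNil e := by
  obtain ⟨M, hM1, ⟨n, hn⟩, hM⟩ := aux_max (R := R) he
  rw [hM] at h
  let S : Submodule R Λ :=
    { carrier := {y | y ∈ auxE R e ∧ ∃ s : R, s ≠ 0 ∧ s • y ∈ M}
      zero_mem' := ⟨Submodule.zero_mem _, 1, one_ne_zero, by simp⟩
      add_mem' := by
        rintro a b ⟨ha, s, hs, hsa⟩ ⟨hb, t, ht, htb⟩
        refine ⟨Submodule.add_mem _ ha hb, s * t, mul_ne_zero hs ht, ?_⟩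
        rw [smul_add, mul_smul s t b, mul_comm s t, mul_smul]
        exact M.add_mem (M.smul_mem _ hsa) (M.smul_mem _ htb)
      smul_mem' := by
        rintro c a ⟨ha, s, hs, hsa⟩
        refine ⟨Submodule.smul_mem _ _ ha, s, hs, ?_⟩
        rw [smul_comm]
        exact M.smul_mem _ hsa }
  have hS : auxCI e S := by
    refine ⟨fun y hy => hy.1, ?_, ?_⟩
    · rw [Submodule.mul_le]
      rintro a ha y ⟨hy, s, hs, hsy⟩
      refine ⟨auxE_mul e (Submodule.mul_mem_mul ha hy), s, hs, ?_⟩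
      rw [← mul_smul_comm]
      exact hM1.2.1 (Submodule.mul_mem_mul ha hsy)
    · rw [Submodule.mul_le]
      rintro y ⟨hy, s, hs, hsy⟩ a ha
      refine ⟨auxE_mul e (Submodule.mul_mem_mul hy ha), s, hs, ?_⟩
      rw [← smul_mul_assoc]
      exact hM1.2.2 (Submodule.mul_mem_mul hsy ha)
  -- `N` as a submodule
  let N' : Submodule R Λ :=
    { carrier := N
      zero_mem' := N.zero_mem
      add_mem' := fun ha hb => N.add_mem ha hb
      smul_mem' := fun c a ha => by
        rw [Algebra.smul_def]
        exact N.mul_mem_left _ _ ha }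
  have hpow : ∀ k : ℕ, ∀ y ∈ S ^ (k + 1), ∃ s : R, s ≠ 0 ∧ s • y ∈ M ^ (k + 1) := by
    intro k
    induction k with
    | zero =>
      intro y hy
      rw [zero_add, pow_one] at hy ⊢
      exact hy.2
    | succ k ih =>
      intro y hy
      rw [pow_succ] at hy
      refine Submodule.mul_induction_on hy ?_ ?_
      · rintro a ha b ⟨-, t, ht, htb⟩
        obtain ⟨s, hs, hsa⟩ := ih a ha
        refine ⟨s * t, mul_ne_zero hs ht, ?_⟩
        rw [pow_succ, ← smul_mul_smul_comm]
        exact Submodule.mul_mem_mul hsa htb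
      · rintro a b ⟨s, hs, hsa⟩ ⟨t, ht, htb⟩
        refine ⟨s * t, mul_ne_zero hs ht, ?_⟩
        rw [smul_add, mul_smul s t b, mul_comm s t, mul_smul]
        exact Submodule.add_mem _ (Submodule.smul_mem _ _ hsa) (Submodule.smul_mem _ _ htb)
  have hSN : S ^ (n + 1) ≤ N' := by
    intro y hy
    obtain ⟨s, hs, hsy⟩ := hpow n y hy
    rw [hn, Submodule.mem_bot] at hsy
    have hye := (mem_auxE' he).1 (aux_pow_le hS n hy).1
    have : e * y * e ∈ N := ht y ⟨s, hs, by rw [← hye, hsy]⟩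
    rw [← hye] at this
    exact this
  obtain ⟨m, hm⟩ := (aux_nil_iff N').1 hN
  have hSn : IsNilpotentSet (S : Set Λ) := by
    rw [aux_nil_iff]
    refine ⟨n * m + n + m, ?_⟩
    have h2 : (S ^ (n + 1)) ^ (m + 1) ≤ N' ^ (m + 1) := pow_le_pow_left' hSN _
    rw [hm, ← pow_mul, le_bot_iff] at h2
    rw [← h2]
    congr 1
    ring
  exact ⟨S, ⟨(auxCI_iff he S).1 hS, hSn⟩, ⟨x, hx⟩, r, hr, h⟩

end

/-- **Peirce decomposition of a finite algebra over a Dedekind domain.**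
There are orthogonal idempotents `e₀, e₁` with `e₀ + e₁ = 1` such that, writing
`Λᵢⱼ = eᵢ Λ eⱼ`:
(1) `Λᵢⱼ` is `R`-torsion for `(i,j) ≠ (1,1)`;
(2) `Λ₀₁`, `Λ₁₀` and the `R`-torsion part of `Λ₁₁` lie in `nil Λ`;
(3) `Λ₁₁ / nil Λ₁₁` is semiprime and `R`-torsion-free. -/
theorem finite_algebra_torsion_splitting_idempotents
    (R : Type) [CommRing R] [IsDomain R] [IsDedekindDomain R]
    (Λ : Type) [Ring Λ] [Algebra R Λ] [Module.Finite R Λ] :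
    ∃ e₀ e₁ : Λ, IsIdempotentElem e₀ ∧ IsIdempotentElem e₁ ∧
      e₀ * e₁ = 0 ∧ e₁ * e₀ = 0 ∧ e₀ + e₁ = 1 ∧
      -- (1) `Λ₀₀`, `Λ₀₁`, `Λ₁₀` are torsion `R`-modules
      (∀ x : Λ, ∃ r : R, r ≠ 0 ∧ r • (e₀ * x * e₀) = 0) ∧
      (∀ x : Λ, ∃ r : R, r ≠ 0 ∧ r • (e₀ * x * e₁) = 0) ∧
      (∀ x : Λ, ∃ r : R, r ≠ 0 ∧ r • (e₁ * x * e₀) = 0) ∧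
      -- (2) `Λ₀₁ ∪ Λ₁₀ ∪ tors Λ₁₁ ⊆ nil Λ`
      (∀ x : Λ, e₀ * x * e₁ ∈ nilRad Λ) ∧
      (∀ x : Λ, e₁ * x * e₀ ∈ nilRad Λ) ∧
      (∀ x : Λ, (∃ r : R, r ≠ 0 ∧ r • (e₁ * x * e₁) = 0) → e₁ * x * e₁ ∈ nilRad Λ) ∧
      -- (3) `Λ₁₁/nil Λ₁₁` is semiprime …
      (∀ x : Λ, x = e₁ * x * e₁ →
        (∀ a : Λ, x * (e₁ * a * e₁) * x ∈ cornerNil e₁) → x ∈ cornerNil e₁) ∧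
      -- … and torsion-free as an `R`-module
      (∀ x : Λ, x = e₁ * x * e₁ → ∀ r : R, r ≠ 0 → r • x ∈ cornerNil e₁ →
        x ∈ cornerNil e₁) := by
  obtain ⟨N, e, hN, he, ⟨s, hs, hse⟩, hT⟩ := aux_idem R Λ
  have hle : ∀ x ∈ N, x ∈ nilRad Λ := fun x hx => (le_sSup hN : N ≤ nilRad Λ) hx
  have he1 : IsIdempotentElem (1 - e) := he.one_sub
  have h01 : e * (1 - e) = 0 := by rw [mul_sub, mul_one, he.eq, sub_self]
  have h10 : (1 - e) * e = 0 := by rw [sub_mul, one_mul, he.eq, sub_self]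
  have hleft : ∀ x : Λ, s • (e * x) = 0 := fun x => by rw [← smul_mul_assoc, hse, zero_mul]
  have hright : ∀ x : Λ, s • (x * e) = 0 := fun x => by rw [← mul_smul_comm, hse, mul_zero]
  have htors : ∀ x : Λ, (∃ r : R, r ≠ 0 ∧ r • ((1 - e) * x * (1 - e)) = 0) →
      (1 - e) * x * (1 - e) ∈ N := by
    intro x hx
    have := (hT _ hx).1
    rw [mul_assoc (1 - e), ← mul_assoc e, h01, zero_mul, zero_sub] at this
    rw [mul_assoc]
    simpa using N.neg_mem this
  refine ⟨e, 1 - e, he, he1, h01, h10, by abel, fun x => ⟨s, hs, hright _⟩,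
    fun x => ⟨s, hs, by rw [mul_assoc]; exact hleft _⟩, fun x => ⟨s, hs, hright _⟩, ?_, ?_,
    fun x hx => hle _ (htors x hx), ?_, ?_⟩
  · intro x
    apply hle
    have := N.neg_mem (hT (e * x) ⟨s, hs, hleft x⟩).2
    rwa [show e * x * (1 - e) = -(e * x * e - e * x) by noncomm_ring]
  · intro x
    apply hle
    have := N.neg_mem (hT (x * e) ⟨s, hs, hright x⟩).1
    rwa [show (1 - e) * x * e = -(e * (x * e) - x * e) by noncomm_ring]
  · exact fun x hx h => aux_semiprime (R := R) he1 x hx h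
  · exact fun x hx r hr h => aux_torsfree he1 N hN htors x hx r hr h
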